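/- arXiv:2407.06353 — 2 statements merged into one kernel-verified Lean document; each statement's English description precedes it below -/
import Mathlib

section
/- If the generalized Auslander–Reiten conjecture holds for all associative rings with identity (i.e., for every ring S, every finitely generated left S-module M, and every integer n ≥ 0, Ext^i_S(M, M ⊕ S) = 0 for all i > n implies pd(_S M) ≤ n), then the Wakamatsu tilting conjecture holds for all associative rings with identity: for every ring R, every Wakamatsu tilting right R-module of finite projective dimension is a tilting module. -/
/-!
Common definitions for formalizing the Wakamatsu tilting conjecture paper.
All rings are associative with identity; right `R`-modules are treated as
left `Rᵐᵒᵖ`-modules.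
-/

open CategoryTheory

universe u

/-- Vanishing of `Ext^n_S(X, Y)` for left `S`-modules. -/
abbrev ExtVanish (S : Type u) [Ring S] (n : ℕ) (X Y : ModuleCat.{u} S) : Prop :=
  Subsingleton (((Ext ℤ (ModuleCat.{u} S) n).obj (Opposite.op X)).obj Y)

/-- `N ∈ add_S T`: `N` is a direct summand of a finite direct sum of copies of `T`. -/
def MemAdd (S : Type u) [Ring S] (T N : ModuleCat.{u} S) : Prop :=
  ∃ (k : ℕ) (M : ModuleCat.{u} S), Nonempty ((↥N × ↥M) ≃ₗ[S] (Fin k → ↥T))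

/-- `N ∈ gen*_S(T)`: there is an exact sequence `⋯ → X_1 → X_0 → N → 0` with all
`X_i ∈ add_S T` and `Ext^1_S(T, Ker f_i) = 0` for all `i ≥ 0`. -/
def MemGenStar (S : Type u) [Ring S] (T N : ModuleCat.{u} S) : Prop :=
  ∃ (X : ℕ → ModuleCat.{u} S) (f : ∀ i, ↥(X (i + 1)) →ₗ[S] ↥(X i)) (f0 : ↥(X 0) →ₗ[S] ↥N),
    (∀ i, MemAdd S T (X i)) ∧
    Function.Surjective f0 ∧
    Function.Exact (f 0) f0 ∧
    (∀ i, Function.Exact (f (i + 1)) (f i)) ∧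
    ExtVanish S 1 T (ModuleCat.of S (LinearMap.ker f0)) ∧
    (∀ i, ExtVanish S 1 T (ModuleCat.of S (LinearMap.ker (f i))))

/-- The projective dimension of the left `S`-module `M` is at most `n`: there is a projective
resolution `0 → P_n → ⋯ → P_0 → M → 0`. -/
def PdLE (S : Type u) [Ring S] (M : ModuleCat.{u} S) (n : ℕ) : Prop :=
  ∃ (P : ℕ → ModuleCat.{u} S) (d : ∀ i, ↥(P (i + 1)) →ₗ[S] ↥(P i)) (ε : ↥(P 0) →ₗ[S] ↥M),
    (∀ i, Module.Projective S ↥(P i)) ∧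
    Function.Surjective ε ∧
    Function.Exact (d 0) ε ∧
    (∀ i, Function.Exact (d (i + 1)) (d i)) ∧
    (∀ i, n < i → Subsingleton ↥(P i))

/-- The projective dimension of `M` equals `n`. -/
def PdEq (S : Type u) [Ring S] (M : ModuleCat.{u} S) (n : ℕ) : Prop :=
  PdLE S M n ∧ ∀ m, PdLE S M m → n ≤ m

/-- `N ∈ T^⊥`: `Ext^i_S(T, N) = 0` for all `i ≥ 1`. -/
def MemPerp (S : Type u) [Ring S] (T N : ModuleCat.{u} S) : Prop :=
  ∀ i, 1 ≤ i → ExtVanish S i T N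

/-- `N ∈ X_T = T^⊥ ∩ gen*_S(T)`. -/
def MemXT (S : Type u) [Ring S] (T N : ModuleCat.{u} S) : Prop :=
  MemPerp S T N ∧ MemGenStar S T N

/-- There is an exact sequence `0 → B → X_0 → ⋯ → X_n → 0` with all `X_i ∈ add_S T`. -/
def HasFiniteAddCoresolution (S : Type u) [Ring S] (T B : ModuleCat.{u} S) (n : ℕ) : Prop :=
  ∃ (X : ℕ → ModuleCat.{u} S) (g : ∀ i, ↥(X i) →ₗ[S] ↥(X (i + 1))) (g0 : ↥B →ₗ[S] ↥(X 0)),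
    (∀ i, i ≤ n → MemAdd S T (X i)) ∧
    (∀ i, n < i → Subsingleton ↥(X i)) ∧
    Function.Injective g0 ∧
    Function.Exact g0 (g 0) ∧
    (∀ i, Function.Exact (g i) (g (i + 1)))

/-- `T` is an `n`-tilting left `A`-module (Miyashita); applying this with `A = Rᵐᵒᵖ`
gives the notion for right `R`-modules. -/
def IsNTilting (A : Type u) [Ring A] (T : ModuleCat.{u} A) (n : ℕ) : Prop :=
  MemGenStar A (ModuleCat.of A A) T ∧
  PdLE A T n ∧
  (∀ i, 0 < i → ExtVanish A i T T) ∧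
  HasFiniteAddCoresolution A T (ModuleCat.of A A) n

/-- `T` is a Wakamatsu tilting left `A`-module (Definition 2.2); applying this with
`A = Rᵐᵒᵖ` gives the notion for right `R`-modules: `T ∈ gen*(A)`, `Ext^i_A(T,T) = 0` for
`i > 0`, and there is an exact sequence `0 → A → X_0 → X_1 → ⋯` with `X_i ∈ add T`
which stays exact after applying `Hom_A(-, T)`. -/
def IsWakamatsuTilting (A : Type u) [Ring A] (T : ModuleCat.{u} A) : Prop :=
  MemGenStar A (ModuleCat.of A A) T ∧
  (∀ i, 0 < i → ExtVanish A i T T) ∧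
  ∃ (X : ℕ → ModuleCat.{u} A) (g : ∀ i, ↥(X i) →ₗ[A] ↥(X (i + 1))) (g0 : A →ₗ[A] ↥(X 0)),
    (∀ i, MemAdd A T (X i)) ∧
    Function.Injective g0 ∧
    Function.Exact g0 (g 0) ∧
    (∀ i, Function.Exact (g i) (g (i + 1))) ∧
    Function.Surjective (fun h : ↥(X 0) →ₗ[A] ↥T => h.comp g0) ∧
    Function.Exact (fun h : ↥(X 1) →ₗ[A] ↥T => h.comp (g 0))
      (fun h : ↥(X 0) →ₗ[A] ↥T => h.comp g0) ∧
    (∀ i, Function.Exact (fun h : ↥(X (i + 2)) →ₗ[A] ↥T => h.comp (g (i + 1)))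
      (fun h : ↥(X (i + 1)) →ₗ[A] ↥T => h.comp (g i)))

/-- The subgroup of `T ⊗_ℤ M` generated by the balancing relations `(t·r) ⊗ m - t ⊗ (r·m)`;
the quotient of `T ⊗_ℤ M` by it is the balanced tensor product `T ⊗_R M`. -/
noncomputable def TensorRel (R : Type u) [Ring R] (T : Type u) [AddCommGroup T]
    [Module Rᵐᵒᵖ T] (M : Type u) [AddCommGroup M] [Module R M] :
    AddSubgroup (TensorProduct ℤ T M) :=
  AddSubgroup.closure
    {x | ∃ (t : T) (r : R) (m : M),
      x = (MulOpposite.op r • t) ⊗ₜ[ℤ] m - t ⊗ₜ[ℤ] (r • m)}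

/-- The right `R`-module `T` is tensorly faithful: `T ⊗_R M ≠ 0` for every nonzero left
`R`-module `M` (equivalently, the balancing relations do not exhaust `T ⊗_ℤ M`). -/
def TensorlyFaithful (R : Type u) [Ring R] (T : Type u) [AddCommGroup T]
    [Module Rᵐᵒᵖ T] : Prop :=
  ∀ (M : Type u) [AddCommGroup M] [Module R M], Nontrivial M → TensorRel R T M ≠ ⊤

/-- The natural ring homomorphism `Rᵐᵒᵖ →+* End(_S T)` induced by the right `R`-action;
it being bijective says exactly that `R → End(_S T)ᵒᵖ` is an isomorphism. -/
def rightEndNat (S R : Type u) [Ring S] [Ring R] (T : Type u) [AddCommGroup T] [Module S T]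
    [Module Rᵐᵒᵖ T] [SMulCommClass S Rᵐᵒᵖ T] : Rᵐᵒᵖ →+* Module.End S T :=
  haveI := SMulCommClass.symm S Rᵐᵒᵖ T
  Module.toModuleEnd S T

/-- The bimodule `T` is Wakamatsu tilting, i.e. a semidualizing `(S,R)`-bimodule
(Lemma 2.3(iii)). -/
def IsSemidualizing (S R : Type u) [Ring S] [Ring R] (T : Type u) [AddCommGroup T]
    [Module S T] [Module Rᵐᵒᵖ T] [SMulCommClass S Rᵐᵒᵖ T] : Prop :=
  MemGenStar Rᵐᵒᵖ (ModuleCat.of Rᵐᵒᵖ Rᵐᵒᵖ) (ModuleCat.of Rᵐᵒᵖ T) ∧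
  MemGenStar S (ModuleCat.of S S) (ModuleCat.of S T) ∧
  Function.Bijective (Module.toModuleEnd Rᵐᵒᵖ T : S →+* Module.End Rᵐᵒᵖ T) ∧
  Function.Bijective (rightEndNat S R T) ∧
  (∀ i, 0 < i → ExtVanish Rᵐᵒᵖ i (ModuleCat.of Rᵐᵒᵖ T) (ModuleCat.of Rᵐᵒᵖ T)) ∧
  (∀ i, 0 < i → ExtVanish S i (ModuleCat.of S T) (ModuleCat.of S T))

/-- The left `R`-module structure on `Hom_S(T, M)` given by `(r • f) t = f (t · r)`. -/
def homModule (S R : Type u) [Ring S] [Ring R] (T : Type u) [AddCommGroup T] [Module S T]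
    [Module Rᵐᵒᵖ T] [SMulCommClass S Rᵐᵒᵖ T] (M : Type u) [AddCommGroup M] [Module S M] :
    Module R (T →ₗ[S] M) where
  smul r f :=
    { toFun := fun t => f (MulOpposite.op r • t)
      map_add' := fun t₁ t₂ => by
        show f (MulOpposite.op r • (t₁ + t₂)) = _
        rw [smul_add, map_add]
      map_smul' := fun s t => by
        show f (MulOpposite.op r • (s • t)) = s • f (MulOpposite.op r • t)
        rw [← smul_comm s (MulOpposite.op r) t, map_smul] }
  one_smul f := by
    apply LinearMap.ext; intro t
    show f ((MulOpposite.op (1 : R)) • t) = f t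
    rw [MulOpposite.op_one, one_smul]
  mul_smul r₁ r₂ f := by
    apply LinearMap.ext; intro t
    show f ((MulOpposite.op (r₁ * r₂)) • t) = f (MulOpposite.op r₂ • MulOpposite.op r₁ • t)
    rw [MulOpposite.op_mul, mul_smul]
  smul_zero r := by apply LinearMap.ext; intro t; rfl
  smul_add r f g := by apply LinearMap.ext; intro t; rfl
  add_smul r₁ r₂ f := by
    apply LinearMap.ext; intro t
    show f ((MulOpposite.op (r₁ + r₂)) • t) = f (MulOpposite.op r₁ • t) + f (MulOpposite.op r₂ • t)
    rw [MulOpposite.op_add, add_smul, map_add]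
  zero_smul f := by
    apply LinearMap.ext; intro t
    show f ((MulOpposite.op (0 : R)) • t) = 0
    rw [MulOpposite.op_zero, zero_smul, map_zero]

/-- The evaluation map `T ⊗_ℤ Hom_S(T, M) → M`, `t ⊗ h ↦ h t`. -/
noncomputable def evalMap (S : Type u) [Ring S] (T : Type u) [AddCommGroup T] [Module S T]
    (M : Type u) [AddCommGroup M] [Module S M] :
    TensorProduct ℤ T (T →ₗ[S] M) →ₗ[ℤ] M :=
  TensorProduct.lift
    (LinearMap.mk₂ ℤ (fun t h => h t)
      (fun t₁ t₂ h => by show h (t₁ + t₂) = h t₁ + h t₂; rw [map_add])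
      (fun z t h => by show h (z • t) = z • h t; rw [map_zsmul])
      (fun t h₁ h₂ => rfl)
      (fun z t h => rfl))

/-- `Tor^R_i(T, N) = 0` for all `i ≥ 1`: for every projective resolution `P_•` of the left
`R`-module `N`, the induced complex `T ⊗_R P_•` is exact in positive degrees (expressed
via the presentation of `T ⊗_R -` as a quotient of `T ⊗_ℤ -` by the balancing relations). -/
def TorVanishPos (R : Type u) [Ring R] (T : Type u) [AddCommGroup T] [Module Rᵐᵒᵖ T]
    (N : Type u) [AddCommGroup N] [Module R N] : Prop :=
  ∀ (P : ℕ → ModuleCat.{u} R) (d : ∀ i, ↥(P (i + 1)) →ₗ[R] ↥(P i)) (ε : ↥(P 0) →ₗ[R] N),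
    (∀ i, Module.Projective R ↥(P i)) → Function.Surjective ε →
    Function.Exact (d 0) ε → (∀ i, Function.Exact (d (i + 1)) (d i)) →
    ∀ (i : ℕ) (x : TensorProduct ℤ T ↥(P (i + 1))),
      TensorProduct.map (LinearMap.id : T →ₗ[ℤ] T)
          ((d i).toAddMonoidHom.toIntLinearMap) x ∈ TensorRel R T ↥(P i) →
      ∃ y : TensorProduct ℤ T ↥(P (i + 2)),
        x - TensorProduct.map (LinearMap.id : T →ₗ[ℤ] T)
          ((d (i + 1)).toAddMonoidHom.toIntLinearMap) y ∈ TensorRel R T ↥(P (i + 1))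

/-- `M` belongs to the Bass class `B_T(S)`: the evaluation map
`T ⊗_R Hom_S(T, M) → M` is an isomorphism (it is surjective, and its kernel is exactly the
subgroup of balancing relations), `Ext^i_S(T, M) = 0` and `Tor^R_i(T, Hom_S(T, M)) = 0`
for all `i ≥ 1`. -/
def MemBass (S R : Type u) [Ring S] [Ring R] (T : Type u) [AddCommGroup T] [Module S T]
    [Module Rᵐᵒᵖ T] [SMulCommClass S Rᵐᵒᵖ T] (M : Type u) [AddCommGroup M] [Module S M] :
    Prop :=
  letI := homModule S R T M
  Function.Surjective (evalMap S T M) ∧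
  (∀ x, evalMap S T M x = 0 ↔ x ∈ TensorRel R T (T →ₗ[S] M)) ∧
  (∀ i, 1 ≤ i → ExtVanish S i (ModuleCat.of S T) (ModuleCat.of S M)) ∧
  TorVanishPos R T (T →ₗ[S] M)

/-- `R` is a left max ring: every nonzero left `R`-module has a maximal (proper) submodule. -/
def IsLeftMaxRing (R : Type u) [Ring R] : Prop :=
  ∀ (M : Type u) [AddCommGroup M] [Module R M], Nontrivial M → ∃ N : Submodule R M, IsCoatom N

/-- `R` is left Kasch: every simple quotient `R/n` by a maximal left ideal embeds as a
left ideal of `R`. -/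
def IsLeftKasch (R : Type u) [Ring R] : Prop :=
  ∀ n : Submodule R R, IsCoatom n → ∃ I : Submodule R R, Nonempty ((R ⧸ n) ≃ₗ[R] ↥I)

/-- `⋯ → P 1 → P 0 → M → 0` is a projective resolution of `M`. -/
structure IsProjRes (S : Type u) [Ring S] (M : ModuleCat.{u} S) (P : ℕ → ModuleCat.{u} S)
    (d : ∀ i, ↥(P (i + 1)) →ₗ[S] ↥(P i)) (ε : ↥(P 0) →ₗ[S] ↥M) : Prop where
  projective : ∀ i, Module.Projective S ↥(P i)
  surjective : Function.Surjective ε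
  exact_zero : Function.Exact (d 0) ε
  exact_succ : ∀ i, Function.Exact (d (i + 1)) (d i)

/-- The complex `Hom(P, N)` is exact in degree `i + 1`. -/
def HomExactAt {S : Type u} [Ring S] {P : ℕ → ModuleCat.{u} S}
    (d : ∀ i, ↥(P (i + 1)) →ₗ[S] ↥(P i)) (N : Type u) [AddCommGroup N] [Module S N] (i : ℕ) :
    Prop :=
  ∀ φ : ↥(P (i + 1)) →ₗ[S] N, φ ∘ₗ d (i + 1) = 0 → ∃ ψ : ↥(P i) →ₗ[S] N, ψ ∘ₗ d i = φ

section Bridge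

variable {S : Type u} [Ring S] {M : ModuleCat.{u} S} {P : ℕ → ModuleCat.{u} S}
  {d : ∀ i, ↥(P (i + 1)) →ₗ[S] ↥(P i)} {ε : ↥(P 0) →ₗ[S] ↥M}

/-- The chain complex underlying a resolution by linear maps. -/
noncomputable abbrev IsProjRes.complex (h : IsProjRes S M P d ε) :
    ChainComplex (ModuleCat.{u} S) ℕ :=
  ChainComplex.of P (fun i => ModuleCat.ofHom (d i)) (fun i => by
    ext x
    exact (h.exact_succ i).apply_apply_eq_zero x)

theorem IsProjRes.complex_d (h : IsProjRes S M P d ε) (i : ℕ) :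
    h.complex.d (i + 1) i = ModuleCat.ofHom (d i) := by
  simp [complex]

theorem IsProjRes.complex_exactAt_succ (h : IsProjRes S M P d ε) (i : ℕ) :
    h.complex.ExactAt (i + 1) := by
  rw [HomologicalComplex.exactAt_iff' _ (i + 1 + 1) (i + 1) i (by simp) (by simp),
    ShortComplex.ShortExact.moduleCat_exact_iff_function_exact]
  have := h.exact_succ i
  change Function.Exact (h.complex.d (i + 1 + 1) (i + 1)) (h.complex.d (i + 1) i)
  rw [h.complex_d, h.complex_d]
  exact this

/-- A resolution by linear maps, as a categorical projective resolution. -/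
noncomputable def IsProjRes.toProjectiveResolution (h : IsProjRes S M P d ε) :
    ProjectiveResolution M where
  complex := h.complex
  projective i := by
    have := h.projective i
    exact ModuleCat.projective_of_categoryTheory_projective (P i)
  π := (ChainComplex.toSingle₀Equiv _ _).symm ⟨ModuleCat.ofHom ε, by
    rw [h.complex_d]
    ext x
    exact h.exact_zero.apply_apply_eq_zero x⟩
  quasiIso := ⟨fun n => by
    cases n
    · rw [ChainComplex.quasiIsoAt₀_iff, ShortComplex.quasiIso_iff_of_zeros']
      · refine ⟨(ShortComplex.ShortExact.moduleCat_exact_iff_function_exact _).2 ?_,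
          (ModuleCat.epi_iff_surjective _).2 ?_⟩
        · change Function.Exact (h.complex.d 1 0)
            (((ChainComplex.toSingle₀Equiv h.complex M).symm ⟨ModuleCat.ofHom ε, _⟩).f 0)
          rw [ChainComplex.toSingle₀Equiv_symm_apply_f_zero, h.complex_d]
          exact h.exact_zero
        · change Function.Surjective
            (((ChainComplex.toSingle₀Equiv h.complex M).symm ⟨ModuleCat.ofHom ε, _⟩).f 0)
          rw [ChainComplex.toSingle₀Equiv_symm_apply_f_zero]
          exact h.surjective
      all_goals rfl
    · rw [quasiIsoAt_iff_exactAt']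
      · apply h.complex_exactAt_succ
      · apply ChainComplex.exactAt_succ_single_obj⟩

theorem IsProjRes.extVanish_iff (h : IsProjRes S M P d ε) (N : ModuleCat.{u} S) (i : ℕ) :
    ExtVanish S (i + 1) M N ↔ HomExactAt d ↥N i := by
  have e := h.toProjectiveResolution.isoExt (R := ℤ) (i + 1) N
  have h1 : ExtVanish S (i + 1) M N ↔
      (h.complex.linearYonedaObj ℤ N).ExactAt (i + 1) := by
    rw [HomologicalComplex.exactAt_iff_isZero_homology, ExtVanish,
      ← ModuleCat.isZero_iff_subsingleton]
    exact e.isZero_iff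
  rw [h1, HomologicalComplex.exactAt_iff' _ i (i + 1) (i + 1 + 1) (by simp) (by simp),
    ShortComplex.ShortExact.moduleCat_exact_iff_function_exact]
  change Function.Exact (fun ψ : P i ⟶ N => h.complex.d (i + 1) i ≫ ψ)
    (fun φ : P (i + 1) ⟶ N => h.complex.d (i + 1 + 1) (i + 1) ≫ φ) ↔ _
  rw [h.complex_d, h.complex_d]
  constructor
  · intro H φ hφ
    obtain ⟨ψ, hψ⟩ := (H (ModuleCat.ofHom φ)).1 (by
      ext x; exact LinearMap.congr_fun hφ x)
    exact ⟨ψ.hom, congrArg ModuleCat.Hom.hom hψ⟩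
  · intro H φ
    constructor
    · intro hφ
      obtain ⟨ψ, hψ⟩ := H φ.hom (congrArg ModuleCat.Hom.hom hφ)
      exact ⟨ModuleCat.ofHom ψ, ModuleCat.hom_ext hψ⟩
    · rintro ⟨ψ, rfl⟩
      ext x
      exact (congrArg ψ.hom ((h.exact_succ i).apply_apply_eq_zero x)).trans (map_zero _)

end Bridge

section HomExactAt

variable {S : Type u} [Ring S] {P : ℕ → ModuleCat.{u} S}
  {d : ∀ i, ↥(P (i + 1)) →ₗ[S] ↥(P i)}

/-- A map killing the image of the first map of an exact pair factors through the second
map, when the latter is surjective. -/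
theorem exists_factor_of_exact {L M N Q : Type*} [AddCommGroup L] [AddCommGroup M]
    [AddCommGroup N] [AddCommGroup Q] [Module S L] [Module S M] [Module S N] [Module S Q]
    {f : L →ₗ[S] M} {p : M →ₗ[S] N} (hfp : Function.Exact f p) (hp : Function.Surjective p)
    (φ : M →ₗ[S] Q) (hφ : φ ∘ₗ f = 0) : ∃ ψ : N →ₗ[S] Q, ψ ∘ₗ p = φ := by
  have hker : LinearMap.ker p ≤ LinearMap.ker φ := by
    intro x hx
    obtain ⟨y, rfl⟩ := (hfp x).1 hx
    exact LinearMap.congr_fun hφ y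
  refine ⟨(Submodule.liftQ _ φ hker) ∘ₗ (p.quotKerEquivOfSurjective hp).symm.toLinearMap, ?_⟩
  ext x
  have : (p.quotKerEquivOfSurjective hp).symm (p x) = Submodule.Quotient.mk x := by
    rw [LinearEquiv.symm_apply_eq]; rfl
  simp [this]

theorem HomExactAt.prod {N N' : Type u} [AddCommGroup N] [Module S N] [AddCommGroup N']
    [Module S N'] {i : ℕ} (h : HomExactAt d N i) (h' : HomExactAt d N' i) :
    HomExactAt d (N × N') i := by
  intro φ hφ
  obtain ⟨ψ, hψ⟩ := h (LinearMap.fst S N N' ∘ₗ φ) (by rw [LinearMap.comp_assoc, hφ]; simp)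
  obtain ⟨ψ', hψ'⟩ := h' (LinearMap.snd S N N' ∘ₗ φ) (by rw [LinearMap.comp_assoc, hφ]; simp)
  refine ⟨ψ.prod ψ', LinearMap.ext fun x => Prod.ext ?_ ?_⟩
  · exact LinearMap.congr_fun hψ x
  · exact LinearMap.congr_fun hψ' x

theorem HomExactAt.of_subsingleton (N : Type u) [AddCommGroup N] [Module S N] {i : ℕ}
    (h : Subsingleton ↥(P (i + 1))) : HomExactAt d N i := fun φ _ =>
  ⟨0, LinearMap.ext fun x => by rw [Subsingleton.elim x 0, map_zero, map_zero]⟩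

theorem HomExactAt.of_sum_eq {T N : Type u} [AddCommGroup T] [Module S T] [AddCommGroup N]
    [Module S N] {i k : ℕ} (h : HomExactAt d T i) (p : Fin k → N →ₗ[S] T)
    (q : Fin k → T →ₗ[S] N) (hpq : ∀ x, ∑ j, q j (p j x) = x) : HomExactAt d N i := by
  intro φ hφ
  choose ψ hψ using fun j => h (p j ∘ₗ φ) (by rw [LinearMap.comp_assoc, hφ]; simp)
  refine ⟨∑ j, q j ∘ₗ ψ j, LinearMap.ext fun x => ?_⟩
  have hx : ∀ j, ψ j (d i x) = p j (φ x) := fun j => LinearMap.congr_fun (hψ j) x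
  simp [hx, hpq]

variable {B C : Type u} [AddCommGroup B] [Module S B] [AddCommGroup C] [Module S C]

/-- Exactness for the kernel of a surjection, one degree up, passes to the target. -/
theorem HomExactAt.of_ker {M : ModuleCat.{u} S} {ε : ↥(P 0) →ₗ[S] ↥M}
    (hP : IsProjRes S M P d ε) (π : B →ₗ[S] C) (hπ : Function.Surjective π) {i : ℕ}
    (hK : HomExactAt d ↥(LinearMap.ker π) (i + 1)) (hB : HomExactAt d B i) :
    HomExactAt d C i := by
  intro φ hφ
  have := hP.projective (i + 1)
  obtain ⟨φ', rfl⟩ := Module.projective_lifting_property π φ hπ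
  obtain ⟨θ, hθ⟩ := hK ((φ' ∘ₗ d (i + 1)).codRestrict _ fun x => LinearMap.congr_fun hφ x) (by
    refine LinearMap.ext fun x => Subtype.ext ?_
    change φ' (d (i + 1) (d (i + 1 + 1) x)) = 0
    rw [(hP.exact_succ (i + 1)).apply_apply_eq_zero x, map_zero])
  have hθ' : ∀ x, (θ (d (i + 1) x) : B) = φ' (d (i + 1) x) := fun x =>
    congrArg Subtype.val (LinearMap.congr_fun hθ x)
  obtain ⟨χ, hχ⟩ := hB (φ' - (LinearMap.ker π).subtype ∘ₗ θ) (by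
    ext x
    simp [hθ'])
  refine ⟨π ∘ₗ χ, ?_⟩
  rw [LinearMap.comp_assoc, hχ]
  ext x
  simp

/-- Maps out of `M` lift along a surjection whose kernel has no `Ext¹` from `M`. -/
theorem HomExactAt.exists_lift {M : ModuleCat.{u} S} {ε : ↥(P 0) →ₗ[S] ↥M}
    (hP : IsProjRes S M P d ε) (π : B →ₗ[S] C) (hπ : Function.Surjective π)
    (hK : HomExactAt d ↥(LinearMap.ker π) 0) (φ : ↥M →ₗ[S] C) :
    ∃ ψ : ↥M →ₗ[S] B, π ∘ₗ ψ = φ := by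
  have := hP.projective 0
  obtain ⟨φ', hφ'⟩ := Module.projective_lifting_property π (φ ∘ₗ ε) hπ
  have hφx : ∀ x, π (φ' x) = φ (ε x) := fun x => LinearMap.congr_fun hφ' x
  obtain ⟨θ, hθ⟩ := hK ((φ' ∘ₗ d 0).codRestrict _ fun x => by
      simp [hφx, hP.exact_zero.apply_apply_eq_zero x]) (by
    ext x
    simp [(hP.exact_succ 0).apply_apply_eq_zero x])
  have hθ' : ∀ x, (θ (d 0 x) : B) = φ' (d 0 x) := fun x =>
    congrArg Subtype.val (LinearMap.congr_fun hθ x)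
  obtain ⟨χ, hχ⟩ := exists_factor_of_exact hP.exact_zero hP.surjective
    (φ' - (LinearMap.ker π).subtype ∘ₗ θ) (by ext x; simp [hθ'])
  refine ⟨χ, LinearMap.ext fun y => ?_⟩
  obtain ⟨x, rfl⟩ := hP.surjective y
  have hχx : χ (ε x) = φ' x - θ x := LinearMap.congr_fun hχ x
  simp [hχx, hφx]

end HomExactAt

section Add

variable {A : Type u} [Ring A] {T : ModuleCat.{u} A}

theorem memAdd_iff {X : ModuleCat.{u} A} : MemAdd A T X ↔
    ∃ (k : ℕ) (p : Fin k → ↥X →ₗ[A] ↥T) (q : Fin k → ↥T →ₗ[A] ↥X),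
      ∀ x, ∑ j, q j (p j x) = x := by
  constructor
  · rintro ⟨k, M, ⟨e⟩⟩
    refine ⟨k, fun j => LinearMap.proj j ∘ₗ e.toLinearMap ∘ₗ LinearMap.inl A X M,
      fun j => LinearMap.fst A X M ∘ₗ e.symm.toLinearMap ∘ₗ LinearMap.single A (fun _ => ↥T) j,
      fun x => ?_⟩
    have : ∑ j, Pi.single j (e (x, 0) j) = e (x, 0) := Finset.univ_sum_single _
    calc _ = (e.symm (∑ j, Pi.single j (e (x, 0) j))).1 := by
          rw [map_sum, Prod.fst_sum]; rfl
      _ = x := by rw [this, e.symm_apply_apply]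
  · rintro ⟨k, p, q, h⟩
    let a : ↥X →ₗ[A] (Fin k → ↥T) := LinearMap.pi p
    let b : (Fin k → ↥T) →ₗ[A] ↥X := ∑ j, q j ∘ₗ LinearMap.proj j
    have hab : ∀ x, b (a x) = x := fun x => by simpa [a, b] using h x
    refine ⟨k, ModuleCat.of A (LinearMap.ker b), ⟨
      { toFun := fun y => a y.1 + y.2.1
        map_add' := fun y z => by simp; abel
        map_smul' := fun c y => by simp
        invFun := fun t => (b t, ⟨t - a (b t), by simp [hab]⟩)
        left_inv := fun y => ?_
        right_inv := fun t => by simp }⟩⟩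
    have hy : b y.2.1 = 0 := y.2.2
    refine Prod.ext ?_ (Subtype.ext ?_) <;> simp [hab, hy]

/-- Splicing a short exact sequence in front of a finite coresolution. -/
theorem HasFiniteAddCoresolution.cons {B X C : ModuleCat.{u} A} {n : ℕ} (hX : MemAdd A T X)
    (f : ↥B →ₗ[A] ↥X) (π : ↥X →ₗ[A] ↥C) (hf : Function.Injective f) (hfπ : Function.Exact f π)
    (hπ : Function.Surjective π) (hC : HasFiniteAddCoresolution A T C n) :
    HasFiniteAddCoresolution A T B (n + 1) := by
  obtain ⟨Y, g, g0, hY, hY0, hg0, hg0g, hg⟩ := hC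
  refine ⟨fun i => Nat.casesOn i X Y, fun i => Nat.casesOn i (g0 ∘ₗ π) g, f, ?_, ?_, hf, ?_, ?_⟩
  · rintro (_ | i) hi
    · exact hX
    · exact hY i (by omega)
  · rintro (_ | i) hi
    · omega
    · exact hY0 i (by omega)
  · intro x
    rw [← hfπ x]
    exact map_eq_zero_iff g0 hg0
  · rintro (_ | i)
    · change Function.Exact (g0 ∘ₗ π) (g 0)
      intro y
      rw [show Set.range (g0 ∘ₗ π) = Set.range g0 from hπ.range_comp g0]
      exact hg0g y
    · exact hg i

theorem HasFiniteAddCoresolution.zero {B : ModuleCat.{u} A} (hB : MemAdd A T B) :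
    HasFiniteAddCoresolution A T B 0 := by
  refine ⟨fun i => Nat.casesOn i B fun _ => ModuleCat.of A PUnit, fun i => 0, LinearMap.id,
    ?_, ?_, Function.injective_id, ?_, ?_⟩
  · rintro i hi
    obtain rfl : i = 0 := by omega
    exact hB
  · rintro (_ | i) hi
    · omega
    · exact inferInstanceAs (Subsingleton PUnit)
  · intro x
    exact ⟨fun _ => ⟨x, rfl⟩, fun _ => rfl⟩
  · intro i x
    have : Subsingleton PUnit := inferInstance
    exact ⟨fun _ => ⟨0, Subsingleton.elim (α := PUnit) _ _⟩, fun _ => rfl⟩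

variable {X : ℕ → ModuleCat.{u} A} {g : ∀ i, ↥(X i) →ₗ[A] ↥(X (i + 1))}

/-- The corestriction of a differential to the next cocycle module. -/
def toKer (hg : ∀ i, Function.Exact (g i) (g (i + 1))) (i : ℕ) :
    ↥(X i) →ₗ[A] ↥(LinearMap.ker (g (i + 1))) :=
  (g i).codRestrict _ fun x => (hg i).apply_apply_eq_zero x

theorem toKer_surjective (hg : ∀ i, Function.Exact (g i) (g (i + 1))) (i : ℕ) :
    Function.Surjective (toKer hg i) := by
  rintro ⟨y, hy⟩
  obtain ⟨x, rfl⟩ := (hg i y).1 hy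
  exact ⟨x, rfl⟩

theorem ker_toKer (hg : ∀ i, Function.Exact (g i) (g (i + 1))) (i : ℕ) :
    LinearMap.ker (toKer hg i) = LinearMap.ker (g i) :=
  LinearMap.ker_codRestrict _ _ _

/-- Truncating a coresolution at a cocycle module lying in `add T`. -/
theorem HasFiniteAddCoresolution.ker (hX : ∀ i, MemAdd A T (X i))
    (hg : ∀ i, Function.Exact (g i) (g (i + 1))) (k i : ℕ)
    (h : MemAdd A T (ModuleCat.of A (LinearMap.ker (g (i + k))))) :
    HasFiniteAddCoresolution A T (ModuleCat.of A (LinearMap.ker (g i))) k := by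
  induction k generalizing i with
  | zero => exact .zero h
  | succ k ih =>
    refine .cons (hX i) (LinearMap.ker (g i)).subtype (toKer hg i) (Submodule.subtype_injective _)
      ?_ (toKer_surjective hg i) (ih (i + 1) ?_)
    · rw [LinearMap.exact_iff, ker_toKer, Submodule.range_subtype]
    · rwa [show i + 1 + k = i + (k + 1) by omega]

theorem HasFiniteAddCoresolution.of_equiv {B B' : ModuleCat.{u} A} {n : ℕ}
    (e : ↥B ≃ₗ[A] ↥B') (h : HasFiniteAddCoresolution A T B' n) :
    HasFiniteAddCoresolution A T B n := by
  obtain ⟨Y, g, g0, hY, hY0, hg0, hg0g, hg⟩ := h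
  refine ⟨Y, g, g0 ∘ₗ e.toLinearMap, hY, hY0, hg0.comp e.injective, fun x => ?_, hg⟩
  rw [show Set.range (g0 ∘ₗ e.toLinearMap) = Set.range g0 from e.surjective.range_comp g0]
  exact hg0g x

end Add

section Dual

variable {A : Type u} [Ring A] (T : ModuleCat.{u} A)

/-- Precomposition with `f`, as a map of modules over the endomorphism ring of `T`. -/
def dualMap {X Y : Type u} [AddCommGroup X] [Module A X] [AddCommGroup Y] [Module A Y]
    (f : X →ₗ[A] Y) : (Y →ₗ[A] ↥T) →ₗ[Module.End A ↥T] (X →ₗ[A] ↥T) where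
  toFun h := h ∘ₗ f
  map_add' _ _ := rfl
  map_smul' _ _ := rfl

variable {T} {X : Type u} [AddCommGroup X] [Module A X] {k : ℕ} {p : Fin k → X →ₗ[A] ↥T}
  {q : Fin k → ↥T →ₗ[A] X}

theorem eq_sum_smul_of_sum_eq (hpq : ∀ x, ∑ j, q j (p j x) = x) (h : X →ₗ[A] ↥T) :
    h = ∑ j, (h ∘ₗ q j : Module.End A ↥T) • p j := by
  ext x
  conv_lhs => rw [← hpq x]
  simp

theorem eq_zero_of_forall_dual (hpq : ∀ x, ∑ j, q j (p j x) = x)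
    (x : X) (hx : ∀ h : X →ₗ[A] ↥T, h x = 0) : x = 0 := by
  rw [← hpq x]
  simp [hx]

/-- Every functional from the dual of `X` to `T` is an evaluation. -/
theorem dual_apply_eq (hpq : ∀ x, ∑ j, q j (p j x) = x)
    (Φ : (X →ₗ[A] ↥T) →ₗ[Module.End A ↥T] ↥T) (h : X →ₗ[A] ↥T) :
    Φ h = h (∑ j, q j (Φ (p j))) := by
  conv_lhs => rw [eq_sum_smul_of_sum_eq hpq h]
  simp

/-- Every functional from the dual of `X` to the endomorphism ring of `T` is a composition. -/
theorem exists_comp_eq (hpq : ∀ x, ∑ j, q j (p j x) = x)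
    (Φ : (X →ₗ[A] ↥T) →ₗ[Module.End A ↥T] Module.End A ↥T) :
    ∃ θ : ↥T →ₗ[A] X, ∀ h, Φ h = h ∘ₗ θ := by
  refine ⟨∑ j, q j ∘ₗ Φ (p j), fun h => ?_⟩
  conv_lhs => rw [eq_sum_smul_of_sum_eq hpq h]
  ext t
  simp

theorem exists_split_dual (hpq : ∀ x, ∑ j, q j (p j x) = x) :
    ∃ (a : (X →ₗ[A] ↥T) →ₗ[Module.End A ↥T] (Fin k → Module.End A ↥T))
    (b : (Fin k → Module.End A ↥T) →ₗ[Module.End A ↥T] (X →ₗ[A] ↥T)),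
    b ∘ₗ a = LinearMap.id := by
  refine ⟨LinearMap.pi fun j => dualMap T (q j),
    ∑ j, (LinearMap.toSpanSingleton (Module.End A ↥T) _ (p j)) ∘ₗ LinearMap.proj j, ?_⟩
  refine LinearMap.ext fun h => ?_
  conv_rhs => rw [LinearMap.id_apply, eq_sum_smul_of_sum_eq hpq h]
  simp [dualMap]

theorem projective_dual (hpq : ∀ x, ∑ j, q j (p j x) = x) :
    Module.Projective (Module.End A ↥T) (X →ₗ[A] ↥T) := by
  obtain ⟨a, b, h⟩ := exists_split_dual hpq
  exact .of_split a b h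

theorem finite_dual (hpq : ∀ x, ∑ j, q j (p j x) = x) :
    Module.Finite (Module.End A ↥T) (X →ₗ[A] ↥T) := by
  obtain ⟨a, b, h⟩ := exists_split_dual hpq
  exact .of_surjective b fun y => ⟨a y, LinearMap.congr_fun h y⟩

end Dual

section Wakamatsu

variable {A : Type u} [Ring A] {T : ModuleCat.{u} A} {X : ℕ → ModuleCat.{u} A}
  {g : ∀ i, ↥(X i) →ₗ[A] ↥(X (i + 1))}

/-- If `T` has projective dimension at most `n` and no self-extensions, then `Hom(T, -)` of an
`add T`-coresolution is exact above degree `n`. -/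
theorem exists_lift_of_pdLE {P : ℕ → ModuleCat.{u} A}
    {d : ∀ i, ↥(P (i + 1)) →ₗ[A] ↥(P i)} {ε : ↥(P 0) →ₗ[A] ↥T} (hP : IsProjRes A T P d ε)
    {n : ℕ} (hn : ∀ i, n < i → Subsingleton ↥(P i)) (hT : ∀ i, 0 < i → ExtVanish A i T T)
    (hX : ∀ i, MemAdd A T (X i)) (hg : ∀ i, Function.Exact (g i) (g (i + 1)))
    {k : ℕ} (hk : n ≤ k) (θ : ↥T →ₗ[A] ↥(X (k + 1))) (hθ : ∀ t, g (k + 1) (θ t) = 0) :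
    ∃ θ' : ↥T →ₗ[A] ↥(X k), g k ∘ₗ θ' = θ := by
  have hXE : ∀ k i, HomExactAt d (X k) i := fun k i => by
    obtain ⟨m, p, q, hpq⟩ := memAdd_iff.1 (hX k)
    exact ((hP.extVanish_iff T i).1 (hT (i + 1) i.succ_pos)).of_sum_eq p q hpq
  have hK : ∀ k i, n ≤ k + i → HomExactAt d ↥(LinearMap.ker (g k)) i := by
    intro k
    induction k with
    | zero => exact fun i hi => .of_subsingleton _ (hn (i + 1) (by omega))
    | succ k ih =>
      intro i hi
      refine .of_ker hP (toKer hg k) (toKer_surjective hg k) ?_ (hXE k i)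
      rw [ker_toKer]
      exact ih (i + 1) (by omega)
  obtain ⟨θ', hθ'⟩ := HomExactAt.exists_lift hP (toKer hg k) (toKer_surjective hg k)
    (by rw [ker_toKer]; exact hK k 0 hk) (θ.codRestrict _ hθ)
  exact ⟨θ', LinearMap.ext fun t => congrArg Subtype.val (LinearMap.congr_fun hθ' t)⟩

variable (T X) in
/-- The terms of the `T`-dual of a coresolution. -/
abbrev dualObj (i : ℕ) : ModuleCat.{u} (Module.End A ↥T) :=
  ModuleCat.of (Module.End A ↥T) (X i →ₗ[A] ↥T)

variable (T g) in
/-- The differential of the `T`-dual of a coresolution. -/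
def dualDiff (i : ℕ) : ↥(dualObj T X (i + 1)) →ₗ[Module.End A ↥T] ↥(dualObj T X i) :=
  dualMap T (g i)

/-- The cocycle module in degree `n` of an `add T`-coresolution lies in `add T` if every
cohomology class of the `T`-dual in degree `n + 1` vanishes. -/
theorem memAdd_ker_of_homExactAt (hX : ∀ i, MemAdd A T (X i))
    (hgT : ∀ i, Function.Exact (dualDiff T g (i + 1)) (dualDiff T g i)) {n : ℕ}
    (h : HomExactAt (P := dualObj T X) (dualDiff T g) (LinearMap.range (dualDiff T g n)) n) :
    MemAdd A T (ModuleCat.of A (LinearMap.ker (g n))) := by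
  obtain ⟨ψ, hψ⟩ := h (dualDiff T g n).rangeRestrict (by
    refine LinearMap.ext fun x => Subtype.ext ?_
    exact (hgT n).apply_apply_eq_zero x)
  let Ψ : (↥(X n) →ₗ[A] ↥T) →ₗ[Module.End A ↥T] (↥(X n) →ₗ[A] ↥T) :=
    (LinearMap.range (dualDiff T g n)).subtype ∘ₗ ψ
  have hΨ : ∀ f : ↥(X (n + 1)) →ₗ[A] ↥T, Ψ (f ∘ₗ g n) = f ∘ₗ g n :=
    fun f => congrArg Subtype.val (LinearMap.congr_fun hψ f)
  have hΨ' : ∀ (f : ↥(X n) →ₗ[A] ↥T) (x : ↥(X n)), g n x = 0 → Ψ f x = 0 := by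
    intro f x hx
    obtain ⟨f', hf' : f' ∘ₗ g n = Ψ f⟩ := (ψ f).2
    rw [← hf', LinearMap.comp_apply, hx, map_zero]
  obtain ⟨k, p, q, hpq⟩ := memAdd_iff.1 (hX n)
  obtain ⟨k₂, p₂, q₂, hpq₂⟩ := memAdd_iff.1 (hX (n + 1))
  let r : ↥(X n) →ₗ[A] ↥(X n) := ∑ j, q j ∘ₗ (p j - Ψ (p j))
  have hr : ∀ (f : ↥(X n) →ₗ[A] ↥T) (x : ↥(X n)), f (r x) = f x - Ψ f x := by
    intro f x
    let ev : (↥(X n) →ₗ[A] ↥T) →ₗ[Module.End A ↥T] ↥T :=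
      ⟨⟨fun f => f x, fun _ _ => rfl⟩, fun _ _ => rfl⟩
    refine Eq.trans ?_ (dual_apply_eq hpq (ev ∘ₗ (LinearMap.id - Ψ)) f).symm
    simp [r, ev]
  have hrker : ∀ x, r x ∈ LinearMap.ker (g n) := fun x =>
    eq_zero_of_forall_dual hpq₂ _ fun f => by
      have := hr (f ∘ₗ g n) x
      rwa [hΨ, sub_self] at this
  have hrid : ∀ x, g n x = 0 → r x = x := fun x hx => by
    rw [← sub_eq_zero]
    refine eq_zero_of_forall_dual hpq _ fun f => ?_
    rw [map_sub, hr, hΨ' f x hx]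
    simp
  refine memAdd_iff.2 ⟨k, fun j => p j ∘ₗ (LinearMap.ker (g n)).subtype,
    fun j => (r.codRestrict _ hrker) ∘ₗ q j, fun x => Subtype.ext ?_⟩
  have hx := hrid x.1 x.2
  rw [← hpq x.1, map_sum, hpq] at hx
  exact (Submodule.coe_sum _ _ _).trans hx

/-- A Wakamatsu tilting module of finite projective dimension is tilting, provided its
projective dimension over its endomorphism ring is controlled by `Ext`-vanishing. -/
theorem IsWakamatsuTilting.isNTilting {n : ℕ} (hW : IsWakamatsuTilting A T) (hpd : PdLE A T n)
    (hS : (∀ i, n < i → ExtVanish (Module.End A ↥T) i (ModuleCat.of (Module.End A ↥T) ↥T)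
        (ModuleCat.of (Module.End A ↥T) (↥T × Module.End A ↥T))) →
      Module.Finite (Module.End A ↥T) ↥T →
      PdLE (Module.End A ↥T) (ModuleCat.of (Module.End A ↥T) ↥T) n) :
    IsNTilting A T n := by
  obtain ⟨hgen, hT, X, g, g0, hX, hg0, hg0g, hg, hsurj, hex0, hex⟩ := hW
  refine ⟨hgen, hpd, hT, ?_⟩
  obtain ⟨P, d, ε, hproj, hε, hd0, hd, hn⟩ := hpd
  have hP : IsProjRes A T P d ε := ⟨hproj, hε, hd0, hd⟩
  choose k p q hpq using fun i => memAdd_iff.1 (hX i)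
  let ε' : ↥(dualObj T X 0) →ₗ[Module.End A ↥T]
      ↥(ModuleCat.of (Module.End A ↥T) ↥T) :=
    { toFun := fun h : ↥(X 0) →ₗ[A] ↥T => h (g0 1)
      map_add' := fun _ _ => rfl
      map_smul' := fun _ _ => rfl }
  have hres : IsProjRes (Module.End A ↥T) (ModuleCat.of _ ↥T)
      (dualObj T X) (dualDiff T g) ε' := by
    refine ⟨fun i => projective_dual (hpq i), fun t => ?_, fun f => ?_, fun i => hex i⟩
    · obtain ⟨f, hf⟩ := hsurj (LinearMap.toSpanSingleton A ↥T t)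
      exact ⟨f, (LinearMap.congr_fun hf 1).trans (one_smul A t)⟩
    · refine Iff.trans ?_ (hex0 f)
      refine ⟨fun h => LinearMap.ext_ring h, fun h => LinearMap.congr_fun h 1⟩
  have hET : ∀ i, HomExactAt (P := dualObj T X) (dualDiff T g) ↥T i := by
    intro i φ hφ
    obtain ⟨x, hx⟩ : ∃ x, ∀ f, φ f = f x := ⟨_, dual_apply_eq (hpq (i + 1)) φ⟩
    obtain ⟨y, rfl⟩ := (hg i x).1 (eq_zero_of_forall_dual (hpq (i + 2)) _ fun f =>
      (hx (f ∘ₗ g (i + 1))).symm.trans (LinearMap.congr_fun hφ f))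
    exact ⟨⟨⟨fun f : ↥(X i) →ₗ[A] ↥T => f y, fun _ _ => rfl⟩, fun _ _ => rfl⟩,
      LinearMap.ext fun f => (hx f).symm⟩
  have hES : ∀ i, n ≤ i → HomExactAt (P := dualObj T X) (dualDiff T g) (Module.End A ↥T) i := by
    intro i hi φ hφ
    obtain ⟨θ, hθ⟩ := exists_comp_eq (hpq (i + 1)) φ
    obtain ⟨θ', rfl⟩ := exists_lift_of_pdLE hP hn hT hX hg hi θ fun t =>
      eq_zero_of_forall_dual (hpq (i + 2)) _ fun f =>
        LinearMap.congr_fun ((hθ (f ∘ₗ g (i + 1))).symm.trans (LinearMap.congr_fun hφ f)) t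
    exact ⟨⟨⟨fun f : ↥(X i) →ₗ[A] ↥T => f ∘ₗ θ', fun _ _ => rfl⟩, fun _ _ => rfl⟩,
      LinearMap.ext fun f => (hθ f).symm⟩
  obtain ⟨Q, dQ, εQ, hQproj, hεQ, hdQ0, hdQ, hQn⟩ := hS
    (fun i hi => by
      obtain ⟨i, rfl⟩ := Nat.exists_eq_add_of_lt hi
      exact (hres.extVanish_iff _ (n + i)).2 ((hET _).prod (hES _ (by omega))))
    (haveI := finite_dual (hpq 0); Module.Finite.of_surjective ε' hres.surjective)
  have hQ : IsProjRes (Module.End A ↥T) (ModuleCat.of _ ↥T) Q dQ εQ :=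
    ⟨hQproj, hεQ, hdQ0, hdQ⟩
  have hker : MemAdd A T (ModuleCat.of A (LinearMap.ker (g (0 + n)))) := by
    rw [Nat.zero_add]
    refine memAdd_ker_of_homExactAt hX hex ?_
    exact (hres.extVanish_iff (ModuleCat.of _ _) n).1
      ((hQ.extVanish_iff _ n).2 (.of_subsingleton _ (hQn (n + 1) n.lt_succ_self)))
  refine (HasFiniteAddCoresolution.ker hX hg n 0 hker).of_equiv ?_
  exact (LinearEquiv.ofInjective g0 hg0).trans
    (LinearEquiv.ofEq _ _ (LinearMap.exact_iff.1 hg0g).symm)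

end Wakamatsu

/-- Theorem 1.3. If the generalized Auslander–Reiten conjecture holds for
all rings, then the Wakamatsu tilting conjecture holds for all rings: every Wakamatsu tilting
right `R`-module of finite projective dimension is tilting. -/
theorem garc_all_rings_implies_wtc_all_rings
    (hGARC : ∀ (S : Type u) [Ring S] (M : Type u) [AddCommGroup M] [Module S M],
      Module.Finite S M → ∀ n : ℕ,
      (∀ i, n < i → ExtVanish S i (ModuleCat.of S M) (ModuleCat.of S (M × S))) →
      PdLE S (ModuleCat.of S M) n) :
    ∀ (R : Type u) [Ring R] (T : Type u) [AddCommGroup T] [Module Rᵐᵒᵖ T],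
      IsWakamatsuTilting Rᵐᵒᵖ (ModuleCat.of Rᵐᵒᵖ T) →
      (∃ n : ℕ, PdLE Rᵐᵒᵖ (ModuleCat.of Rᵐᵒᵖ T) n) →
      ∃ n : ℕ, IsNTilting Rᵐᵒᵖ (ModuleCat.of Rᵐᵒᵖ T) n := by
  intro R _ T _ _ hW ⟨n, hpd⟩
  exact ⟨n, hW.isNTilting hpd fun hE hfin => hGARC _ T hfin n hE⟩
end

section
/- Let S be an associative ring with identity and let T be a left S-module with T ∈ gen*_S(S) and Ext^i_S(T,T) = 0 for all i > 0. Then add_S T = X_T ∩ ^⊥X_T; that is, a left S-module N is isomorphic to a direct summand of a finite direct sum of copies of T if and only if N belongs to X_T and Ext^i_S(N, X) = 0 for all i ≥ 1 and all X in X_T. -/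
/-!
Common definitions for formalizing the Wakamatsu tilting conjecture paper.
All rings are associative with identity; right `R`-modules are treated as
left `Rᵐᵒᵖ`-modules.
-/

open CategoryTheory

universe u

section ExtCriteria

open Limits

variable {C : Type*} [Category* C] [Abelian C] [Linear ℤ C] [EnoughProjectives C]

/-- Vanishing of `Ext` in positive degree, computed from a projective resolution: every cocycle
is a coboundary. -/
lemma subsingleton_ext_succ_iff {X : C} (P : ProjectiveResolution X) (n : ℕ) (Y : C) :
    Subsingleton (((Ext ℤ C (n + 1)).obj (Opposite.op X)).obj Y) ↔
      ∀ φ : P.complex.X (n + 1) ⟶ Y, P.complex.d (n + 2) (n + 1) ≫ φ = 0 →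
        ∃ ψ : P.complex.X n ⟶ Y, P.complex.d (n + 1) n ≫ ψ = φ := by
  rw [← ModuleCat.isZero_iff_subsingleton, (P.isoExt (n + 1) Y).isZero_iff,
    ← HomologicalComplex.exactAt_iff_isZero_homology,
    HomologicalComplex.exactAt_iff' _ n (n + 1) (n + 2) (by simp) (by simp),
    ShortComplex.moduleCat_exact_iff]
  rfl

/-- An object whose identity is a finite sum of endomorphisms factoring through `T` has
vanishing `Ext^(n+1)` into every `Y` for which `T` does. -/
lemma subsingleton_ext_succ_of_sum_left {ι : Type*} [Fintype ι] {T N Y : C}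
    (f : ι → (N ⟶ T)) (g : ι → (T ⟶ N)) (h : ∑ j, f j ≫ g j = 𝟙 N) (n : ℕ)
    (hT : Subsingleton (((Ext ℤ C (n + 1)).obj (Opposite.op T)).obj Y)) :
    Subsingleton (((Ext ℤ C (n + 1)).obj (Opposite.op N)).obj Y) := by
  let P := projectiveResolution T
  let Q := projectiveResolution N
  rw [subsingleton_ext_succ_iff P] at hT
  rw [subsingleton_ext_succ_iff Q]
  intro φ hφ
  let a j := ProjectiveResolution.lift (f j) Q P
  let b j := ProjectiveResolution.lift (g j) P Q
  have hb j : P.complex.d (n + 2) (n + 1) ≫ (b j).f (n + 1) ≫ φ = 0 := by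
    rw [← (b j).comm_assoc, hφ, comp_zero]
  choose ψ hψ using fun j => hT _ (hb j)
  let e : Homotopy (𝟙 Q.complex) (∑ j, a j ≫ b j) :=
    ProjectiveResolution.liftHomotopy (𝟙 N) _ _ (by simp) (by
      rw [Preadditive.sum_comp, ← h, Functor.map_sum, Preadditive.comp_sum]
      exact Finset.sum_congr rfl fun j _ => by simp [a, b])
  refine ⟨∑ j, (a j).f n ≫ ψ j + e.hom n (n + 1) ≫ φ, ?_⟩
  have he := e.comm (n + 1)
  rw [dNext_eq e.hom (show (ComplexShape.down ℕ).Rel (n + 1) n from rfl),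
    prevD_eq e.hom (show (ComplexShape.down ℕ).Rel (n + 2) (n + 1) from rfl)] at he
  have hs : (∑ j, a j ≫ b j).f (n + 1) = ∑ j, (a j).f (n + 1) ≫ (b j).f (n + 1) := by
    rw [← HomologicalComplex.Hom.fAddMonoidHom_apply, map_sum]
    rfl
  rw [hs] at he
  have := congrArg (· ≫ φ) he
  simp only [HomologicalComplex.id_f, Category.id_comp, Preadditive.add_comp, Category.assoc,
    hφ, comp_zero, add_zero, Preadditive.sum_comp] at this
  refine Eq.trans ?_ this.symm
  rw [Preadditive.comp_add, Preadditive.comp_sum]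
  refine (add_comm _ _).trans (congrArg _ ?_)
  refine Finset.sum_congr rfl fun j _ => ?_
  rw [← hψ j, (a j).comm_assoc]

/-- An object whose identity is a finite sum of endomorphisms factoring through `T` has
vanishing `Ext^(n+1)` from every `X` for which `T` does. -/
lemma subsingleton_ext_succ_of_sum_right {ι : Type*} [Fintype ι] {T N X : C}
    (f : ι → (N ⟶ T)) (g : ι → (T ⟶ N)) (h : ∑ j, f j ≫ g j = 𝟙 N) (n : ℕ)
    (hT : Subsingleton (((Ext ℤ C (n + 1)).obj (Opposite.op X)).obj T)) :
    Subsingleton (((Ext ℤ C (n + 1)).obj (Opposite.op X)).obj N) := by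
  let P := projectiveResolution X
  rw [subsingleton_ext_succ_iff P] at hT ⊢
  intro φ hφ
  choose ψ hψ using fun j => hT (φ ≫ f j) (by rw [reassoc_of% hφ, zero_comp])
  refine ⟨∑ j, ψ j ≫ g j, ?_⟩
  rw [Preadditive.comp_sum, ← Category.comp_id φ, ← h, Preadditive.comp_sum]
  exact Finset.sum_congr rfl fun j _ => by rw [← Category.assoc, hψ, Category.assoc]

/-- Dimension shifting in the second variable of `Ext` along a short exact sequence. -/
lemma subsingleton_ext_add_two_of_shortExact {E : ShortComplex C} (hE : E.ShortExact) (T : C)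
    (n : ℕ) (h₃ : Subsingleton (((Ext ℤ C (n + 1)).obj (Opposite.op T)).obj E.X₃))
    (h₂ : Subsingleton (((Ext ℤ C (n + 2)).obj (Opposite.op T)).obj E.X₂)) :
    Subsingleton (((Ext ℤ C (n + 2)).obj (Opposite.op T)).obj E.X₁) := by
  have := hE.mono_f
  have := hE.epi_g
  let P := projectiveResolution T
  rw [subsingleton_ext_succ_iff P] at h₃
  rw [subsingleton_ext_succ_iff P (n + 1)] at h₂ ⊢
  intro φ hφ
  obtain ⟨ψ, hψ⟩ := h₂ (φ ≫ E.f) (by rw [reassoc_of% hφ, zero_comp])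
  obtain ⟨χ, hχ⟩ := h₃ (ψ ≫ E.g) (by rw [reassoc_of% hψ, E.zero, comp_zero])
  have hz : (ψ - P.complex.d (n + 1) n ≫ Projective.factorThru χ E.g) ≫ E.g = 0 := by
    simp [hχ]
  refine ⟨hE.exact.lift _ hz, ?_⟩
  rw [← cancel_mono E.f, Category.assoc, hE.exact.lift_f]
  simp [hψ]

/-- If `Ext^1` of the outer terms of a short exact sequence vanishes, the sequence splits. -/
lemma exists_section_of_subsingleton_ext_one {E : ShortComplex C} (hE : E.ShortExact)
    (h : Subsingleton (((Ext ℤ C 1).obj (Opposite.op E.X₃)).obj E.X₁)) :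
    ∃ r : E.X₃ ⟶ E.X₂, r ≫ E.g = 𝟙 _ := by
  have := hE.mono_f
  have := hE.epi_g
  let Q := projectiveResolution E.X₃
  rw [subsingleton_ext_succ_iff Q 0] at h
  let π : Q.complex.X 0 ⟶ E.X₃ := Q.π.f 0
  have hdπ : Q.complex.d 1 0 ≫ π = 0 := Q.complex_d_comp_π_f_zero
  have : Epi π := inferInstanceAs (Epi (Q.π.f 0))
  let s : Q.complex.X 0 ⟶ E.X₂ := Projective.factorThru π E.g
  have hs : s ≫ E.g = π := Projective.factorThru_comp _ _
  have hz : (Q.complex.d 1 0 ≫ s) ≫ E.g = 0 := by rw [Category.assoc, hs, hdπ]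
  obtain ⟨ψ, hψ⟩ := h (hE.exact.lift _ hz) (by
    rw [← cancel_mono E.f, Category.assoc, hE.exact.lift_f]
    simp)
  have hw : Q.complex.d 1 0 ≫ (s - ψ ≫ E.f) = 0 := by
    rw [Preadditive.comp_sub, reassoc_of% hψ, hE.exact.lift_f, sub_self]
  obtain ⟨r, hr⟩ : ∃ r : E.X₃ ⟶ E.X₂, π ≫ r = s - ψ ≫ E.f :=
    ⟨Q.exact₀.desc _ hw, Q.exact₀.g_desc _ hw⟩
  refine ⟨r, ?_⟩
  rw [← cancel_epi π, reassoc_of% hr]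
  simp [hs]

end ExtCriteria

section AddClosure

variable {S : Type u} [Ring S] {T N : ModuleCat.{u} S}

lemma MemAdd.of_subsingleton [Subsingleton N] : MemAdd S T N :=
  ⟨0, ModuleCat.of S PUnit,
    ⟨{ toFun := 0, invFun := 0, map_add' := by simp, map_smul' := by simp
       left_inv := fun _ => Subsingleton.elim _ _
       right_inv := fun _ => Subsingleton.elim _ _ }⟩⟩

/-- A direct summand of a module in `add T` lies in `add T`. -/
lemma MemAdd.of_section {X : ModuleCat.{u} S} (hX : MemAdd S T X) (r : N ⟶ X) (p : X ⟶ N)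
    (h : r ≫ p = 𝟙 N) : MemAdd S T N := by
  obtain ⟨k, M, ⟨e⟩⟩ := hX
  have hrp (x : N) : p.hom (r.hom x) = x := ConcreteCategory.congr_hom h x
  let q : (N × (LinearMap.ker p.hom)) ≃ₗ[S] X :=
    LinearEquiv.ofBijective (r.hom.coprod (LinearMap.ker p.hom).subtype) (by
      constructor
      · rw [← LinearMap.ker_eq_bot, LinearMap.ker_eq_bot']
        rintro ⟨x, y, hy⟩ hxy
        have hxy : r.hom x + y = 0 := by simpa using hxy
        have hx : x = 0 := by
          have := congrArg p.hom hxy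
          rwa [map_add, hrp, LinearMap.mem_ker.1 hy, add_zero, map_zero] at this
        subst hx
        simp_all
      · intro x
        refine ⟨(p.hom x, ⟨x - r.hom (p.hom x), by simp [hrp]⟩), by simp⟩)
  exact ⟨k, ModuleCat.of S (LinearMap.ker p.hom × M),
    ⟨(LinearEquiv.prodAssoc S N (LinearMap.ker p.hom) M).symm.trans
      ((q.prodCongr (LinearEquiv.refl S M)).trans e)⟩⟩

/-- The identity of a module in `add T` is a finite sum of endomorphisms factoring
through `T`. -/
lemma MemAdd.exists_sum_eq_id (h : MemAdd S T N) :
    ∃ (k : ℕ) (f : Fin k → (N ⟶ T)) (g : Fin k → (T ⟶ N)), ∑ j, f j ≫ g j = 𝟙 N := by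
  obtain ⟨k, M, ⟨e⟩⟩ := h
  refine ⟨k,
    fun j => ModuleCat.ofHom (LinearMap.proj j ∘ₗ e.toLinearMap ∘ₗ LinearMap.inl S N M),
    fun j => ModuleCat.ofHom
      (LinearMap.fst S N M ∘ₗ e.symm.toLinearMap ∘ₗ LinearMap.single S (fun _ => T) j), ?_⟩
  ext x
  have key : ∑ j, Pi.single (M := fun _ : Fin k => (T : Type u)) j (e (x, 0) j) = e (x, 0) :=
    Finset.univ_sum_single _
  simp only [ModuleCat.hom_sum, LinearMap.sum_apply]
  change ∑ j, (e.symm (Pi.single j (e (x, 0) j))).1 = x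
  rw [← Prod.fst_sum, ← map_sum, key, e.symm_apply_apply]

lemma MemAdd.extVanish_left (h : MemAdd S T N) {X : ModuleCat.{u} S} {i : ℕ} (hi : 1 ≤ i)
    (hT : ExtVanish S i T X) : ExtVanish S i N X := by
  obtain ⟨n, rfl⟩ := Nat.exists_eq_add_of_le' hi
  obtain ⟨k, f, g, hfg⟩ := h.exists_sum_eq_id
  exact subsingleton_ext_succ_of_sum_left f g hfg n hT

lemma MemAdd.extVanish_right (h : MemAdd S T N) {X : ModuleCat.{u} S} {i : ℕ} (hi : 1 ≤ i)
    (hT : ExtVanish S i X T) : ExtVanish S i X N := by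
  obtain ⟨n, rfl⟩ := Nat.exists_eq_add_of_le' hi
  obtain ⟨k, f, g, hfg⟩ := h.exists_sum_eq_id
  exact subsingleton_ext_succ_of_sum_right f g hfg n hT

lemma extVanish_of_subsingleton (n : ℕ) (T : ModuleCat.{u} S) [Subsingleton N] :
    ExtVanish S (n + 1) T N :=
  (subsingleton_ext_succ_iff (projectiveResolution T) n N).2 fun _ _ =>
    ⟨0, (ModuleCat.isZero_of_subsingleton N).eq_of_tgt _ _⟩

lemma MemAdd.memGenStar (h : MemAdd S T N) : MemGenStar S T N := by
  refine ⟨fun i => Nat.casesOn i N fun _ => ModuleCat.of S PUnit, fun i => 0, LinearMap.id,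
    ?_, Function.surjective_id, ?_, ?_, ?_, ?_⟩
  · rintro (_ | i)
    · exact h
    · exact MemAdd.of_subsingleton (N := ModuleCat.of S PUnit)
  · intro x
    simp [eq_comm]
  · intro i x
    exact ⟨fun _ => ⟨0, Subsingleton.elim (α := PUnit) _ _⟩, fun _ => rfl⟩
  · have : Subsingleton (ModuleCat.of S (LinearMap.ker (LinearMap.id : N →ₗ[S] N))) :=
      ⟨fun x y => Subtype.ext (x.2.trans y.2.symm)⟩
    exact extVanish_of_subsingleton 0 T
  · intro i
    have : Subsingleton (ModuleCat.of S (LinearMap.ker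
        (0 : ModuleCat.of S PUnit →ₗ[S]
          (Nat.casesOn i N fun _ => ModuleCat.of S PUnit : ModuleCat.{u} S)))) :=
      ⟨fun x y => Subtype.ext (Subsingleton.elim (α := PUnit) _ _)⟩
    exact extVanish_of_subsingleton 0 T

/-- A module in `X_T` is the cokernel of a monomorphism from a module in `X_T` to a module
in `add T`. -/
lemma MemXT.exists_shortExact (hext : ∀ i, 0 < i → ExtVanish S i T T) (h : MemXT S T N) :
    ∃ E : ShortComplex (ModuleCat.{u} S), E.ShortExact ∧ MemXT S T E.X₁ ∧ MemAdd S T E.X₂ ∧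
      E.X₃ = N := by
  obtain ⟨hN, X, f, f0, hX, hsurj, hf0, hf, hk0, hk⟩ := h
  let E : ShortComplex (ModuleCat.{u} S) :=
    ShortComplex.moduleCatMk (LinearMap.ker f0).subtype f0 (by ext x; exact x.2)
  have hE : E.ShortExact :=
    { exact := (ShortComplex.moduleCat_exact_iff _).2 fun x hx => ⟨⟨x, hx⟩, rfl⟩
      mono_f := (ModuleCat.mono_iff_injective _).2 Subtype.val_injective
      epi_g := (ModuleCat.epi_iff_surjective _).2 hsurj }
  have hfk x : f 0 x ∈ LinearMap.ker f0 := hf0.apply_apply_eq_zero x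
  refine ⟨E, hE, ⟨?_, fun i => X (i + 1), fun i => f (i + 1),
    (f 0).codRestrict (LinearMap.ker f0) hfk, fun i => hX _,
    ?_, ?_, fun i => hf _, ?_, fun i => hk _⟩, hX 0, rfl⟩
  · rintro (_ | _ | i) hi
    · omega
    · exact hk0
    · exact subsingleton_ext_add_two_of_shortExact hE T i (hN _ (by omega))
        ((hX 0).extVanish_right (by omega) (hext _ (by omega)))
  · rintro ⟨y, hy⟩
    obtain ⟨x, rfl⟩ := (hf0 y).1 hy
    exact ⟨x, rfl⟩
  · intro x
    rw [← hf 0 x]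
    exact Subtype.ext_iff
  · have hk' : ExtVanish S 1 T (ModuleCat.of S
        (LinearMap.ker ((f 0).codRestrict (LinearMap.ker f0) hfk))) := by
      rw [LinearMap.ker_codRestrict]
      exact hk 0
    exact hk'

end AddClosure

/-- Lemma 2.9. Let `T` be a left `S`-module with `T ∈ gen*_S(S)` and
`Ext^i_S(T,T) = 0` for all `i > 0`. Then `add_S T = X_T ∩ ⊥X_T`. -/
theorem memAdd_iff_memXT_and_leftPerp
    (S : Type u) [Ring S] (T : Type u) [AddCommGroup T] [Module S T]
    (hgen : MemGenStar S (ModuleCat.of S S) (ModuleCat.of S T))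
    (hext : ∀ i, 0 < i → ExtVanish S i (ModuleCat.of S T) (ModuleCat.of S T))
    (N : Type u) [AddCommGroup N] [Module S N] :
    MemAdd S (ModuleCat.of S T) (ModuleCat.of S N) ↔
      (MemXT S (ModuleCat.of S T) (ModuleCat.of S N) ∧
        ∀ X : ModuleCat.{u} S, MemXT S (ModuleCat.of S T) X →
          ∀ i, 1 ≤ i → ExtVanish S i (ModuleCat.of S N) X) := by
  constructor
  · exact fun h => ⟨⟨fun i hi => h.extVanish_right hi (hext i hi), h.memGenStar⟩,
      fun X hX i hi => h.extVanish_left hi (hX.1 i hi)⟩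
  · rintro ⟨hN, hperp⟩
    obtain ⟨E, hE, hK, hX, hEN⟩ := hN.exists_shortExact hext
    have hKN := hperp E.X₁ hK 1 le_rfl
    rw [← hEN] at hKN ⊢
    obtain ⟨r, hr⟩ := exists_section_of_subsingleton_ext_one hE hKN
    exact hX.of_section r E.g hr
end
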